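/- Let (K, v) be a henselian valued field and f ∈ 𝒪_v[X] monic of prime degree p such that the reduction of f modulo m_v is separable and irreducible and the splitting field of f over K is cyclic of degree p. Then Disc(f) and f(0) are units of 𝒪_v, and for every t ∈ m_v (i.e., v(t) > 0) the splitting field of f(X) + t·X^{p−1} over K contains the splitting field of f. -/

import Mathlib

open Polynomial Module

/-- A monic polynomial over a local ring is separable if its reduction is. -/
theorem Polynomial.Monic.separable_of_map_residue {R : Type*} [CommRing R] [IsLocalRing R]
    {f : R[X]} (hf : f.Monic) (hsep : (f.map (IsLocalRing.residue R)).Separable) :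
    f.Separable := by
  rw [Polynomial.Separable, ← isUnit_resultant_iff_isCoprime hf]
  rw [Polynomial.Separable, ← isUnit_resultant_iff_isCoprime (hf.map _),
    derivative_map, hf.natDegree_map] at hsep
  apply isUnit_of_map_unit (IsLocalRing.residue R)
  obtain ⟨k, hk⟩ := Nat.exists_eq_add_of_le
    (natDegree_map_le (f := IsLocalRing.residue R) (p := derivative f))
  rw [← resultant_map_map, hk, resultant_add_right_deg _ _ _ _ _ le_rfl]
  simpa [hf.coeff_natDegree] using hsep

/-- If a separable polynomial is divisible by `(X - a) * (X - b)`, then `a - b` is a unit. -/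
theorem Polynomial.Separable.isUnit_sub_of_mul_dvd {R : Type*} [CommRing R] {f : R[X]}
    (hf : f.Separable) {a b : R} (h : (X - C a) * (X - C b) ∣ f) : IsUnit (a - b) := by
  have := ((hf.of_dvd h).isCoprime).map (evalRingHom a)
  simpa [isCoprime_zero_left] using this

theorem Polynomial.Separable.isUnit_sub_of_isRoot {R : Type*} [CommRing R] [IsDomain R] {f : R[X]}
    (hf : f.Separable) {a b : R} (ha : f.IsRoot a) (hb : f.IsRoot b) (hab : a ≠ b) :
    IsUnit (a - b) := by
  obtain ⟨g, rfl⟩ := dvd_iff_isRoot.mpr ha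
  have hg : g.IsRoot b := by
    simpa [sub_eq_zero, hab.symm] using hb
  exact hf.isUnit_sub_of_mul_dvd (mul_dvd_mul_left _ (dvd_iff_isRoot.mpr hg))

open scoped Pointwise in
theorem Ideal.IsMaximal.pointwise_smul {B G : Type*} [CommRing B] [Group G]
    [MulSemiringAction G B] {Q : Ideal B} (hQ : Q.IsMaximal) (g : G) : (g • Q).IsMaximal := by
  rw [Ideal.pointwise_smul_eq_comap]
  exact Ideal.comap_isMaximal_of_surjective _ (MulSemiringAction.toRingEquiv G B g⁻¹).surjective

open scoped Pointwise in
/-- A maximal ideal `Q` has an element of its stabilizer's fixed ring that is congruent to `1`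
modulo `Q` and lies in all the other conjugates of `Q`. -/
theorem Ideal.exists_smul_eq_self_and_sub_one_mem {B G : Type*} [CommRing B] [Group G] [Finite G]
    [MulSemiringAction G B] (Q : Ideal B) [hQ : Q.IsMaximal] :
    ∃ ξ : B, (∀ g : G, g • Q = Q → g • ξ = ξ) ∧ ξ - 1 ∈ Q ∧
      ∀ g : G, g • Q ≠ Q → ξ ∈ g • Q := by
  classical
  cases nonempty_fintype G
  have hmax (g : G) : (g • Q).IsMaximal := hQ.pointwise_smul g
  have htop : Q ⊔ ⨅ g ∈ Finset.univ.filter (fun g : G ↦ g • Q ≠ Q), g • Q = ⊤ :=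
    Ideal.sup_iInf_eq_top fun g hg ↦
      Ideal.isCoprime_iff_sup_eq.mp (Ideal.isCoprime_of_isMaximal (Finset.mem_filter.mp hg).2.symm)
  obtain ⟨q, hq, η, hη, hqη⟩ := Submodule.mem_sup.mp (htop ▸ Submodule.mem_top : (1 : B) ∈ _)
  have hη' : ∀ g : G, g • Q ≠ Q → η ∈ g • Q := by
    simpa [Submodule.mem_iInf] using hη
  refine ⟨∏ h : MulAction.stabilizer G Q, h • η, fun g hg ↦ ?_, ?_, fun g hg ↦ ?_⟩
  · exact Finset.smul_prod_perm η (⟨g, hg⟩ : MulAction.stabilizer G Q)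
  · rw [← Ideal.Quotient.eq, map_prod, map_one]
    refine Finset.prod_eq_one fun h _ ↦ ?_
    rw [← map_one (Ideal.Quotient.mk Q), Ideal.Quotient.eq]
    have h1 : h • η - 1 = -((h : G) • q) := by
      have := congrArg ((h : G) • ·) hqη
      simp only [smul_add, smul_one] at this
      rw [← this, Subgroup.smul_def]; ring
    rw [h1]
    refine Q.neg_mem ?_
    have := Ideal.smul_mem_pointwise_smul (h : G) q Q hq
    rwa [MulAction.mem_stabilizer_iff.mp h.2] at this
  · exact Ideal.mem_of_dvd _ (Finset.dvd_prod_of_mem _ (Finset.mem_univ 1)) (by simpa using hη' g hg)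

open scoped Pointwise in
/-- If a finite group acts on a domain with ring of invariants a henselian local ring, then the
domain is local. -/
theorem HenselianLocalRing.isLocalRing_of_isInvariant (A B G : Type*) [CommRing A]
    [HenselianLocalRing A] [CommRing B] [IsDomain B] [Algebra A B] [Group G] [Finite G]
    [MulSemiringAction G B] [SMulCommClass G A B] [Algebra.IsInvariant A B G] :
    IsLocalRing B := by
  have hint : Algebra.IsIntegral A B := Algebra.IsInvariant.isIntegral A B G
  have hunder (Q : Ideal B) [Q.IsMaximal] : Q.under A = IsLocalRing.maximalIdeal A :=
    IsLocalRing.eq_maximalIdeal (Ideal.isMaximal_comap_of_isIntegral_of_isMaximal Q)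
  have hmem (Q : Ideal B) [Q.IsMaximal] (a : A) :
      algebraMap A B a ∈ Q ↔ a ∈ IsLocalRing.maximalIdeal A := by
    rw [← hunder Q, Ideal.mem_comap]
  obtain ⟨Q, hQ⟩ := Ideal.exists_maximal B
  suffices h : ∀ g : G, g • Q = Q by
    refine IsLocalRing.of_unique_max_ideal ⟨Q, hQ, fun Q' hQ' ↦ ?_⟩
    have : Q'.IsMaximal := hQ'
    obtain ⟨g, hg⟩ := Algebra.IsInvariant.exists_smul_of_under_eq A B G Q Q'
      ((hunder Q).trans (hunder Q').symm)
    exact hg.trans (h g)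
  obtain ⟨ξ, hfix, hξ1, hξ⟩ := Ideal.exists_smul_eq_self_and_sub_one_mem (G := G) Q
  have hξQ : ξ ∉ Q := fun h ↦ hQ.ne_top <| (Ideal.eq_top_iff_one _).mpr <| by
    simpa using Q.sub_mem h hξ1
  classical
  cases nonempty_fintype G
  obtain ⟨q, hq, -, hqm⟩ := lifts_and_natDegree_eq_and_monic (f := algebraMap A B)
    (p := prodXSubSMul G B ξ) ((lifts_iff_coeff_lifts _).mpr fun n ↦
      Algebra.IsInvariant.isInvariant (G := G) _ fun g ↦ prodXSubSMul.coeff G B ξ g n)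
    (prodXSubSMul.monic G B ξ)
  have hroot : q.eval 1 ∈ IsLocalRing.maximalIdeal A := by
    rw [← hmem Q, ← eval_map_apply, hq, map_one]
    have := sub_dvd_eval_sub ξ 1 (prodXSubSMul G B ξ)
    rw [prodXSubSMul.eval, zero_sub, dvd_neg] at this
    exact Q.mem_of_dvd this hξ1
  have hfac : prodXSubSMul G B ξ = (X - C ξ) *
      ∏ g ∈ Finset.univ.erase (QuotientGroup.mk (1 : G) : G ⧸ MulAction.stabilizer G ξ),
        (X - C (MulAction.ofQuotientStabilizer G ξ g)) := by
    rw [prodXSubSMul, ← Finset.mul_prod_erase _ _ (Finset.mem_univ (QuotientGroup.mk (1 : G)))]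
    simp
  have hder : IsUnit (q.derivative.eval 1) := by
    rw [← IsLocalRing.notMem_maximalIdeal, ← hmem Q, ← eval_map_apply, ← derivative_map, hq,
      map_one]
    intro h1
    have h2 : (derivative (prodXSubSMul G B ξ)).eval ξ ∈ Q := by
      have := Q.mem_of_dvd (sub_dvd_eval_sub ξ 1 (derivative (prodXSubSMul G B ξ))) hξ1
      simpa using Q.add_mem this h1
    rw [hfac, derivative_mul] at h2
    simp only [derivative_sub, derivative_X, derivative_C, sub_zero, one_mul, eval_add, eval_mul,
      eval_sub, eval_X, eval_C, sub_self, zero_mul, add_zero, eval_prod] at h2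
    obtain ⟨j, hj, hjQ⟩ := (hQ.isPrime.prod_mem_iff).mp h2
    obtain ⟨g, rfl⟩ := QuotientGroup.mk_surjective j
    rw [MulAction.ofQuotientStabilizer_mk] at hjQ
    have hg : g⁻¹ • Q ≠ Q := fun h ↦ Finset.ne_of_mem_erase hj <| by
      rw [eq_comm, QuotientGroup.eq, inv_one, one_mul]
      exact hfix g (inv_smul_eq_iff.mp h).symm
    have := Ideal.mem_inv_pointwise_smul_iff.mp (hξ _ hg)
    exact hξQ (by simpa using Q.add_mem hjQ this)
  obtain ⟨a, ha, ha1⟩ := HenselianLocalRing.is_henselian q hqm 1 hroot hder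
  have haξ : algebraMap A B a = ξ := by
    have h1 : (prodXSubSMul G B ξ).eval (algebraMap A B a) = 0 := by
      rw [← hq, eval_map_apply, ha.eq_zero, map_zero]
    rw [prodXSubSMul, eval_prod, Finset.prod_eq_zero_iff] at h1
    obtain ⟨j, -, hj⟩ := h1
    obtain ⟨g, rfl⟩ := QuotientGroup.mk_surjective j
    rw [MulAction.ofQuotientStabilizer_mk, eval_sub, eval_X, eval_C, sub_eq_zero] at hj
    rw [← inv_smul_eq_iff.mpr hj, smul_algebraMap]
  intro g
  by_contra hg
  have hgm : (g • Q).IsMaximal := hQ.pointwise_smul g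
  have h1 : ξ - 1 ∈ g • Q := by
    have := (hmem (g • Q) (a - 1)).mpr ha1
    rwa [map_sub, map_one, haξ] at this
  exact hgm.ne_top <| (Ideal.eq_top_iff_one _).mpr <| by
    simpa using (g • Q).sub_mem (hξ g hg) h1

/-- The integral closure of a henselian integrally closed domain in a finite Galois extension of
its fraction field is local. -/
theorem HenselianLocalRing.isLocalRing_integralClosure (A K N : Type*) [CommRing A] [IsDomain A]
    [HenselianLocalRing A] [IsIntegrallyClosed A] [Field K] [Algebra A K] [IsFractionRing A K]
    [Field N] [Algebra K N] [Algebra A N] [IsScalarTower A K N] [FiniteDimensional K N]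
    [IsGalois K N] : IsLocalRing (integralClosure A N) := by
  have : SMulCommClass Gal(N/K) A N := ⟨fun σ a x ↦ by
    simp [Algebra.smul_def, IsScalarTower.algebraMap_apply A K N]⟩
  have : Algebra.IsInvariant A (integralClosure A N) Gal(N/K) := ⟨fun b hb ↦ by
    obtain ⟨y, hy⟩ := (IsGalois.mem_range_algebraMap_iff_fixed (F := K) (b : N)).mpr
      fun σ ↦ congrArg Subtype.val (hb σ)
    have hy' : IsIntegral A y := by
      rw [← isIntegral_algebraMap_iff (algebraMap K N).injective, hy]
      exact b.2
    obtain ⟨a, rfl⟩ := IsIntegrallyClosed.isIntegral_iff.mp hy'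
    exact ⟨a, Subtype.ext (by rw [← hy, ← IsScalarTower.algebraMap_apply]; rfl)⟩⟩
  exact isLocalRing_of_isInvariant A (integralClosure A N) Gal(N/K)

/-- Let `f` and `g` be polynomials over a local ring with the same reduction. If `g` is monic and
splits in an integral local extension, then each root of `f` there is congruent to a root of `g`. -/
theorem IsLocalRing.exists_isRoot_sub_mem_maximalIdeal {A B : Type*} [CommRing A] [IsLocalRing A]
    [CommRing B] [IsDomain B] [IsLocalRing B] [Algebra A B] [Algebra.IsIntegral A B] {f g : A[X]}
    (hg : g.Monic) (hfg : f.map (residue A) = g.map (residue A))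
    (hsplit : (g.map (algebraMap A B)).Splits) {b : B} (hb : (f.map (algebraMap A B)).IsRoot b) :
    ∃ c : B, (g.map (algebraMap A B)).IsRoot c ∧ b - c ∈ maximalIdeal B := by
  have hcomap : (maximalIdeal B).comap (algebraMap A B) = maximalIdeal A :=
    eq_maximalIdeal (Ideal.isMaximal_comap_of_isIntegral_of_isMaximal (maximalIdeal B))
  have : IsLocalHom (algebraMap A B) := ((local_hom_TFAE (algebraMap A B)).out 0 4).mpr hcomap
  have hmem : (g.map (algebraMap A B)).eval b ∈ maximalIdeal B := by
    have key (h : A[X]) : residue B ((h.map (algebraMap A B)).eval b) =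
        ((h.map (residue A)).map (ResidueField.map (algebraMap A B))).eval (residue B b) := by
      rw [Polynomial.map_map, ResidueField.map_comp_residue, ← Polynomial.map_map, eval_map_apply]
    rw [← residue_eq_zero_iff, key, ← hfg, ← key, hb.eq_zero, map_zero]
  rw [hsplit.eval_eq_prod_roots_of_monic (hg.map _),
    (maximalIdeal.isMaximal B).isPrime.multiset_prod_mem_iff_exists_mem] at hmem
  obtain ⟨_, hc, hcm⟩ := hmem
  obtain ⟨c, hcr, rfl⟩ := Multiset.mem_map.mp hc
  exact ⟨c, isRoot_of_mem_roots hcr, hcm⟩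

/-- Let `f` and `g` be monic polynomials with the same separable reduction over a henselian
integrally closed domain. If `g` splits in a finite Galois extension `N` of the fraction field, then
the roots of `f` in `N` lie in every intermediate field that contains the roots of `g`. -/
theorem HenselianLocalRing.mem_intermediateField_of_aeval_eq_zero {A K N : Type*} [CommRing A]
    [IsDomain A] [HenselianLocalRing A] [IsIntegrallyClosed A] [Field K] [Algebra A K]
    [IsFractionRing A K] [Field N] [Algebra K N] [Algebra A N] [IsScalarTower A K N]
    [FiniteDimensional K N] [IsGalois K N] {f g : A[X]} (hf : f.Monic) (hg : g.Monic)
    (hsep : (f.map (IsLocalRing.residue A)).Separable)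
    (hfg : f.map (IsLocalRing.residue A) = g.map (IsLocalRing.residue A))
    (hsplit : (g.map (algebraMap A N)).Splits) {E : IntermediateField K N}
    (hE : ∀ β : N, aeval β g = 0 → β ∈ E) {α : N} (hα : aeval α f = 0) : α ∈ E := by
  let B := integralClosure A N
  have : IsLocalRing B := isLocalRing_integralClosure A K N
  have haut (σ : Gal(N/K)) {b c : B} (hb : b ∈ IsLocalRing.maximalIdeal B)
      (hc : (c : N) = σ b) : c ∈ IsLocalRing.maximalIdeal B := by
    rw [IsLocalRing.mem_maximalIdeal, mem_nonunits_iff] at hb ⊢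
    contrapose! hb
    obtain ⟨d, hd⟩ := hb.exists_right_inv
    have hd' : IsIntegral A (σ.symm (d : N)) :=
      d.2.map (σ.symm.toAlgHom.restrictScalars A)
    refine IsUnit.of_mul_eq_one ⟨_, hd'⟩ (Subtype.ext (σ.injective ?_))
    simpa [hc] using congrArg Subtype.val hd
  have hroot (h : A[X]) (c : B) : (h.map (algebraMap A B)).IsRoot c ↔ aeval (c : N) h = 0 := by
    rw [IsRoot, eval_map_algebraMap, ← (Subtype.val_injective (p := (· ∈ B))).eq_iff]
    exact Eq.congr_left (aeval_algebraMap_apply N c h).symm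
  have hsplitB : (g.map (algebraMap A B)).Splits := by
    have hmap : (g.map (algebraMap A B)).map (algebraMap B N) = g.map (algebraMap A N) := by
      rw [Polynomial.map_map, ← IsScalarTower.algebraMap_eq]
    refine Splits.of_splits_map_of_injective (i := algebraMap B N) Subtype.val_injective
      (hmap ▸ hsplit) fun a ha ↦ ⟨⟨a, g, hg, ?_⟩, rfl⟩
    rw [← eval_map, ← hmap]
    exact isRoot_of_mem_roots ha
  have hαi : IsIntegral A α := ⟨f, hf, hα⟩
  obtain ⟨β, hβ, hαβ⟩ : ∃ β : B, (g.map (algebraMap A B)).IsRoot β ∧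
      (⟨α, hαi⟩ - β : B) ∈ IsLocalRing.maximalIdeal B :=
    IsLocalRing.exists_isRoot_sub_mem_maximalIdeal hg hfg hsplitB ((hroot f _).mpr hα)
  rw [← IsGalois.fixedField_fixingSubgroup E, IntermediateField.mem_fixedField_iff]
  intro σ hσ
  have hσβ : σ β = β :=
    (IntermediateField.mem_fixingSubgroup_iff _ _).mp hσ _ (hE _ ((hroot g β).mp hβ))
  have hσα : aeval (σ α) f = 0 := by
    rw [← σ.coe_restrictScalars A, aeval_algHom_apply, hα, map_zero]
  have hσi : IsIntegral A (σ α) := ⟨f, hf, hσα⟩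
  by_contra hne
  have hmem : (⟨σ α, hσi⟩ - ⟨α, hαi⟩ : B) ∈ IsLocalRing.maximalIdeal B := by
    have := haut σ (c := ⟨σ α, hσi⟩ - β) hαβ (by simp [hσβ])
    simpa using Ideal.sub_mem _ this hαβ
  exact hmem (((hf.separable_of_map_residue hsep).map (f := algebraMap A B)).isUnit_sub_of_isRoot
    ((hroot f _).mpr hσα) ((hroot f _).mpr hα) fun h ↦ hne (congrArg Subtype.val h))

/-- Over a henselian integrally closed domain with fraction field `K`, two monic polynomials with
the same separable reduction have splitting fields that embed into each other over `K`. -/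
theorem HenselianLocalRing.nonempty_splittingField_algHom {A K : Type*} [CommRing A] [IsDomain A]
    [HenselianLocalRing A] [IsIntegrallyClosed A] [Field K] [Algebra A K] [IsFractionRing A K]
    {f g : A[X]} (hf : f.Monic) (hg : g.Monic)
    (hsep : (f.map (IsLocalRing.residue A)).Separable)
    (hfg : f.map (IsLocalRing.residue A) = g.map (IsLocalRing.residue A)) :
    Nonempty ((f.map (algebraMap A K)).SplittingField →ₐ[K]
      (g.map (algebraMap A K)).SplittingField) := by
  have hfs : f.Separable := hf.separable_of_map_residue hsep
  have hgs : g.Separable := hg.separable_of_map_residue (hfg ▸ hsep)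
  set F := f.map (algebraMap A K)
  set G := g.map (algebraMap A K)
  have hF0 : F ≠ 0 := (hf.map _).ne_zero
  have hG0 : G ≠ 0 := (hg.map _).ne_zero
  let N := (F * G).SplittingField
  have hsplit : ((F * G).map (algebraMap K N)).Splits := SplittingField.splits _
  rw [Polynomial.map_mul, splits_mul (map_ne_zero hF0) (map_ne_zero hG0)] at hsplit
  obtain ⟨hFsplit, hGsplit⟩ := hsplit
  have hNsep : Algebra.IsSeparable K N := by
    have h : Algebra.IsSeparable K (IntermediateField.adjoin K ((F * G).rootSet N)) := by
      rw [IntermediateField.isSeparable_adjoin_iff_isSeparable]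
      intro y hy
      rw [mem_rootSet, map_mul, mul_eq_zero] at hy
      rcases hy.2 with hy | hy
      · exact (hfs.map (f := algebraMap A K)).of_dvd (minpoly.dvd K y hy)
      · exact (hgs.map (f := algebraMap A K)).of_dvd (minpoly.dvd K y hy)
    rw [IntermediateField.adjoin_eq_top_of_algebra K _ (SplittingField.adjoin_rootSet (F * G))] at h
    exact (AlgEquiv.Algebra.isSeparable_iff IntermediateField.topEquiv).mp h
  have hNgal : IsGalois K N := { }
  let φ : G.SplittingField →ₐ[K] N := SplittingField.lift G hGsplit
  have hφ : ∀ β ∈ G.rootSet N, β ∈ φ.fieldRange := by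
    rw [← (SplittingField.splits G).image_rootSet φ]
    rintro _ ⟨y, -, rfl⟩
    exact ⟨y, rfl⟩
  have hroot : ∀ α ∈ F.rootSet N, α ∈ φ.fieldRange := by
    intro α hα
    rw [mem_rootSet, aeval_map_algebraMap] at hα
    refine mem_intermediateField_of_aeval_eq_zero (K := K) hf hg hsep hfg ?_ (fun β hβ ↦ ?_) hα.2
    · rwa [Polynomial.map_map, ← IsScalarTower.algebraMap_eq] at hGsplit
    · exact hφ β (mem_rootSet.mpr ⟨hG0, by rwa [aeval_map_algebraMap]⟩)
  have hsplits := IntermediateField.splits_of_splits hFsplit hroot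
  exact ⟨(AlgEquiv.ofInjectiveField φ).symm.toAlgHom.comp (SplittingField.lift F hsplits)⟩

/-- The differences of the roots of a monic separable polynomial with coefficients of value at
most `1` have value `1`. -/
theorem Valuation.map_sub_eq_one_of_separable {R L Γ ι : Type*} [CommRing R] [Field L]
    [LinearOrderedCommGroupWithZero Γ] [Fintype ι] (w : Valuation L Γ) (φ : R →+* L)
    (hφ : ∀ r, w (φ r) ≤ 1) {f : R[X]} (hf : f.Monic) (hsep : f.Separable) {x : ι → L}
    (hx : f.map φ = ∏ i, (X - C (x i))) {i j : ι} (hij : i ≠ j) : w (x i - x j) = 1 := by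
  classical
  let ψ : R →+* w.integer := φ.codRestrict w.integer hφ
  have hψ : w.integer.subtype.comp ψ = φ := rfl
  have hint (i : ι) : x i ∈ w.integer := by
    refine (Valuation.integer.integers w).mem_of_integral ⟨f.map ψ, hf.map ψ, ?_⟩
    change (f.map ψ).eval₂ w.integer.subtype (x i) = 0
    rw [eval₂_map, hψ, ← eval_map, hx, eval_prod]
    exact Finset.prod_eq_zero (Finset.mem_univ i) (by simp)
  have hprod : f.map ψ = ∏ i, (X - C (⟨x i, hint i⟩ : w.integer)) := by
    apply map_injective w.integer.subtype Subtype.val_injective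
    rw [Polynomial.map_map, hψ, hx, Polynomial.map_prod]
    simp
  have hu : IsUnit ((⟨x i, hint i⟩ : w.integer) - ⟨x j, hint j⟩) := by
    refine (hsep.map (f := ψ)).isUnit_sub_of_mul_dvd ?_
    rw [hprod, ← Finset.prod_pair (f := fun i ↦ X - C (⟨x i, hint i⟩ : w.integer)) hij]
    exact Finset.prod_dvd_prod_of_subset _ _ _ (Finset.subset_univ _)
  exact (Valuation.integer.integers w).isUnit_iff_valuation_eq_one.mp hu

/-- If (K,v) is henselian, f ∈ 𝒪_v[X] is monic of prime degree p with separable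
irreducible reduction mod m_v and cyclic splitting field of degree p, then Disc(f)
and f(0) are units of 𝒪_v (multiplicatively: their values are 1, the discriminant
being written as the product of squared root differences in the splitting field),
and for every t ∈ m_v the splitting field of f + t·X^{p−1} contains that of f. -/
theorem stmt_8 (K : Type*) [Field K] (Γ : Type*) [LinearOrderedCommGroupWithZero Γ]
    (v : Valuation K Γ) [HenselianLocalRing ↥v.valuationSubring]
    (p : ℕ) (hp : p.Prime) [NeZero p]
    (f₀ : Polynomial ↥v.valuationSubring) (hmonic : f₀.Monic) (hdeg : f₀.natDegree = p)
    (hirr : Irreducible (f₀.map (IsLocalRing.residue ↥v.valuationSubring)))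
    (hsep : (f₀.map (IsLocalRing.residue ↥v.valuationSubring)).Separable)
    [IsGalois K (f₀.map (algebraMap ↥v.valuationSubring K)).SplittingField]
    (hcyc : IsCyclic ((f₀.map (algebraMap ↥v.valuationSubring K)).SplittingField ≃ₐ[K]
      (f₀.map (algebraMap ↥v.valuationSubring K)).SplittingField))
    (hdim : Module.finrank K (f₀.map (algebraMap ↥v.valuationSubring K)).SplittingField = p)
    (w : Valuation (f₀.map (algebraMap ↥v.valuationSubring K)).SplittingField Γ)
    (hw : ∀ y : K, w (algebraMap K _ y) = v y)
    (x : Fin p → (f₀.map (algebraMap ↥v.valuationSubring K)).SplittingField)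
    (hroots : (f₀.map (algebraMap ↥v.valuationSubring K)).map
        (algebraMap K (f₀.map (algebraMap ↥v.valuationSubring K)).SplittingField)
      = ∏ i : Fin p, (X - C (x i))) :
    w (∏ i : Fin p, ∏ j : Fin p, if i < j then (x i - x j) ^ 2 else 1) = 1 ∧
    IsUnit (f₀.eval 0) ∧
    ∀ t : K, v t < 1 →
      Nonempty ((f₀.map (algebraMap ↥v.valuationSubring K)).SplittingField →ₐ[K]
        (f₀.map (algebraMap ↥v.valuationSubring K) + C t * X ^ (p - 1)).SplittingField) := by
  have hf₀s : f₀.Separable := hmonic.separable_of_map_residue hsep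
  refine ⟨?_, ?_, fun t ht ↦ ?_⟩
  · have hunit {i j : Fin p} (hij : i ≠ j) : w (x i - x j) = 1 :=
      w.map_sub_eq_one_of_separable
        ((algebraMap K _).comp (algebraMap v.valuationSubring K))
        (fun y ↦ (hw y).trans_le y.2) hmonic hf₀s (by rw [← Polynomial.map_map, hroots]) hij
    rw [map_prod]
    refine Finset.prod_eq_one fun i _ ↦ ?_
    rw [map_prod]
    refine Finset.prod_eq_one fun j _ ↦ ?_
    split_ifs with hij
    · rw [map_pow, hunit hij.ne, one_pow]
    · exact map_one w
  · rw [← IsLocalRing.notMem_maximalIdeal, ← IsLocalRing.residue_eq_zero_iff]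
    intro h
    have hroot : (f₀.map (IsLocalRing.residue ↥v.valuationSubring)).IsRoot 0 := by
      rw [IsRoot, ← map_zero (IsLocalRing.residue v.valuationSubring), eval_map_apply, h, map_zero]
    have h1 := natDegree_eq_of_degree_eq_some (degree_eq_one_of_irreducible_of_root hirr hroot)
    rw [hmonic.natDegree_map, hdeg] at h1
    exact hp.ne_one h1
  · have htm : (⟨t, ht.le⟩ : v.valuationSubring) ∈ IsLocalRing.maximalIdeal v.valuationSubring := by
      rw [IsLocalRing.mem_maximalIdeal, mem_nonunits_iff]
      exact Valuation.Integer.not_isUnit_iff_valuation_lt_one.mpr ht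
    set s : v.valuationSubring := ⟨t, ht.le⟩
    have hgdeg : (C s * X ^ (p - 1)).degree < f₀.degree := by
      rw [degree_eq_natDegree hmonic.ne_zero, hdeg]
      refine (degree_C_mul_X_pow_le _ _).trans_lt ?_
      exact_mod_cast Nat.sub_lt hp.pos one_pos
    have := HenselianLocalRing.nonempty_splittingField_algHom (K := K)
      hmonic (hmonic.add_of_left hgdeg) hsep
      (by simp [(IsLocalRing.residue_eq_zero_iff s).mpr htm])
    have hmap : (f₀ + C s * X ^ (p - 1)).map (algebraMap v.valuationSubring K) =
        f₀.map (algebraMap v.valuationSubring K) + C t * X ^ (p - 1) := by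
      simp [s]
    rwa [hmap] at this
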